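/- arXiv:2410.01580 — 4 statements merged into one kernel-verified Lean document; each statement's English description precedes it below -/
import Mathlib

section
/- Let d ≥ 1, x x₀ θ₀ : Fin d → ℝ, α ≥ 0, λ : ℝ, and let L : ℝ → ℝ be antitone (nonincreasing). Then F_α(x) := L(⟪x,θ₀⟫ - α * ‖x‖₁) + λ * ‖x - x₀‖₁ is the greatest element of the set {J(x,θ) | θ ∈ Θ_α(θ₀)}, where J(x,θ) := L(⟪x,θ⟫) + λ * ‖x - x₀‖₁: the worst-case total cost over the uncertainty set is attained and equals F_α(x) (paper's Observation 4 combined with the adversary lemma). -/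
theorem worst_case_total_cost_greatest (d : ℕ) (hd : 1 ≤ d) (x x₀ θ₀ : Fin d → ℝ) (α : ℝ)
    (hα : 0 ≤ α) (lam : ℝ) (L : ℝ → ℝ) (hL : Antitone L) :
    IsGreatest
      {v : ℝ | ∃ θ : Fin d → ℝ, (∀ i, |θ i - θ₀ i| ≤ α) ∧
        v = L (∑ i, x i * θ i) + lam * ∑ i, |x i - x₀ i|}
      (L (∑ i, x i * θ₀ i - α * ∑ i, |x i|) + lam * ∑ i, |x i - x₀ i|) := by
  have key : ∑ i, x i * θ₀ i - α * ∑ i, |x i| = ∑ i, (x i * θ₀ i - α * |x i|) := by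
    rw [Finset.sum_sub_distrib, Finset.mul_sum]
  rw [key]
  constructor
  · refine ⟨fun i => if 0 ≤ x i then θ₀ i - α else θ₀ i + α, ?_, ?_⟩
    · intro i
      dsimp only
      split_ifs
      · rw [abs_le]; constructor <;> linarith
      · rw [abs_le]; constructor <;> linarith
    · congr 2
      apply Finset.sum_congr rfl
      intro i _
      dsimp only
      split_ifs with h
      · rw [abs_of_nonneg h]; ring
      · rw [abs_of_neg (not_le.mp h)]; ring
  · rintro v ⟨θ, hθ, rfl⟩
    have hle : ∑ i, (x i * θ₀ i - α * |x i|) ≤ ∑ i, x i * θ i := by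
      apply Finset.sum_le_sum
      intro i _
      have h1 : |x i * (θ i - θ₀ i)| ≤ |x i| * α := by
        rw [abs_mul]
        exact mul_le_mul_of_nonneg_left (hθ i) (abs_nonneg _)
      have h2 := (abs_le.mp h1).1
      linarith
    have := hL hle
    linarith
end

section
/- Let d ≥ 1, x₀ θ₀ : Fin d → ℝ, α ≥ 0, λ > 0, let L : ℝ → ℝ be antitone (nonincreasing), and let x_r be a global minimizer of F_α (i.e., F_α(x_r) ≤ F_α(x) for all x). Then for every coordinate i: if x₀ i > 0, then θ₀ i ≤ α implies x_r i ≤ x₀ i, and θ₀ i ≥ α implies x_r i ≥ x₀ i; if x₀ i < 0, then θ₀ i ≤ -α implies x_r i ≤ x₀ i, and θ₀ i ≥ -α implies x_r i ≥ x₀ i. (Paper's Lemma on directions: an optimal robust recourse raises coordinate i only if the adversary's response θ₀ i - α·sign(x₀ i) is positive, and lowers it only if it is negative.) -/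
/-- The robust objective `F_α(x) = L(⟪x,θ₀⟫ - α‖x‖₁) + λ‖x - x₀‖₁`. -/
noncomputable def Frob {d : ℕ} (L : ℝ → ℝ) (lam α : ℝ) (x₀ θ₀ : Fin d → ℝ)
    (x : Fin d → ℝ) : ℝ :=
  L (∑ i, x i * θ₀ i - α * ∑ i, |x i|) + lam * ∑ i, |x i - x₀ i|

theorem sum_update_aux {d : ℕ} (f : Fin d → ℝ → ℝ) (x : Fin d → ℝ) (i : Fin d) (t : ℝ) :
    ∑ j, f j (Function.update x i t j) = ∑ j, f j (x j) + (f i t - f i (x i)) := by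
  rw [← Finset.add_sum_erase _ _ (Finset.mem_univ i),
    ← Finset.add_sum_erase _ (fun j => f j (x j)) (Finset.mem_univ i)]
  have : ∑ j ∈ Finset.univ.erase i, f j (Function.update x i t j)
      = ∑ j ∈ Finset.univ.erase i, f j (x j) := by
    apply Finset.sum_congr rfl
    intro j hj
    rw [Function.update_of_ne (Finset.ne_of_mem_erase hj)]
  rw [this, Function.update_self]
  ring

theorem directions (d : ℕ) (hd : 1 ≤ d) (x₀ θ₀ : Fin d → ℝ) (α : ℝ) (hα : 0 ≤ α)
    (lam : ℝ) (hlam : 0 < lam) (L : ℝ → ℝ) (hL : Antitone L) (xr : Fin d → ℝ)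
    (hopt : ∀ x : Fin d → ℝ, Frob L lam α x₀ θ₀ xr ≤ Frob L lam α x₀ θ₀ x) :
    ∀ i : Fin d,
      (0 < x₀ i → (θ₀ i ≤ α → xr i ≤ x₀ i) ∧ (α ≤ θ₀ i → x₀ i ≤ xr i)) ∧
      (x₀ i < 0 → (θ₀ i ≤ -α → xr i ≤ x₀ i) ∧ (-α ≤ θ₀ i → x₀ i ≤ xr i)) := by
  intro i
  have key : xr i * θ₀ i - α * |xr i| ≤ x₀ i * θ₀ i - α * |x₀ i| → xr i = x₀ i := by
    intro h
    have h1 := hopt (Function.update xr i (x₀ i))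
    unfold Frob at h1
    rw [sum_update_aux (fun j t => t * θ₀ j), sum_update_aux (fun _ t => |t|),
      sum_update_aux (fun j t => |t - x₀ j|)] at h1
    simp only [sub_self, abs_zero, zero_sub] at h1
    have h2 : ∑ j, xr j * θ₀ j - α * ∑ j, |xr j| ≤
        ∑ j, xr j * θ₀ j + (x₀ i * θ₀ i - xr i * θ₀ i) -
          α * (∑ j, |xr j| + (|x₀ i| - |xr i|)) := by linarith
    have h3 := hL h2
    have h4 : lam * |xr i - x₀ i| ≤ 0 := by linarith
    have h5 : |xr i - x₀ i| ≤ 0 := by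
      by_contra hc
      push Not at hc
      linarith [mul_pos hlam hc]
    exact sub_eq_zero.mp (abs_nonpos_iff.mp h5)
  have b1 : α * xr i ≤ α * |xr i| := mul_le_mul_of_nonneg_left (le_abs_self _) hα
  have b2 : α * (-xr i) ≤ α * |xr i| := mul_le_mul_of_nonneg_left (neg_le_abs _) hα
  refine ⟨fun h0 => ?_, fun h0 => ?_⟩
  · rw [abs_of_pos h0] at key
    refine ⟨fun hθ => ?_, fun hθ => ?_⟩ <;> by_contra hc <;> push Not at hc
    · have := key (by nlinarith)
      linarith
    · have := key (by nlinarith)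
      linarith
  · rw [abs_of_neg h0] at key
    refine ⟨fun hθ => ?_, fun hθ => ?_⟩ <;> by_contra hc <;> push Not at hc
    · have := key (by nlinarith)
      linarith
    · have := key (by nlinarith)
      linarith
end

section
/- Let d ≥ 1, x x₀ θ₀ : Fin d → ℝ, α ≥ 0, λ ≥ 0, and let L : ℝ → ℝ be antitone (nonincreasing). Fix a coordinate i with x₀ i = 0 and |θ₀ i| ≤ α. Then setting coordinate i of the recourse to zero never increases the worst-case total cost: F_α(Function.update x i 0) ≤ F_α(x). (This justifies the removal of such coordinates from the Active set in Algorithm 1: a coordinate with x₀ i = 0 whose model weight is dominated by the perturbation radius cannot help.) -/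
theorem zeroing_inactive_coordinate (d : ℕ) (hd : 1 ≤ d) (x x₀ θ₀ : Fin d → ℝ) (α : ℝ)
    (hα : 0 ≤ α) (lam : ℝ) (hlam : 0 ≤ lam) (L : ℝ → ℝ) (hL : Antitone L)
    (i : Fin d) (hx₀ : x₀ i = 0) (hθ : |θ₀ i| ≤ α) :
    Frob L lam α x₀ θ₀ (Function.update x i 0) ≤ Frob L lam α x₀ θ₀ x := by
  unfold Frob
  apply add_le_add
  · apply hL
    rw [Finset.mul_sum, Finset.mul_sum, ← Finset.sum_sub_distrib, ← Finset.sum_sub_distrib]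
    apply Finset.sum_le_sum
    intro j _
    by_cases hj : j = i
    · subst hj
      simp only [Function.update_self, abs_zero, mul_zero, zero_mul, sub_zero]
      have h1 : x j * θ₀ j ≤ |x j| * |θ₀ j| := by
        rw [← abs_mul]
        exact le_abs_self _
      have h2 := mul_le_mul_of_nonneg_left hθ (abs_nonneg (x j))
      linarith
    · simp [Function.update_of_ne hj]
  · apply mul_le_mul_of_nonneg_left _ hlam
    apply Finset.sum_le_sum
    intro j _
    by_cases hj : j = i
    · subst hj
      simp [hx₀]
    · simp [Function.update_of_ne hj]
end

section
/- Let d ≥ 1, x x₀ θ' : Fin d → ℝ, λ : ℝ, and let L : ℝ → ℝ be antitone (nonincreasing). Let j be a coordinate with |θ' i| ≤ |θ' j| for all i, set t := ‖x - x₀‖₁ and s := 1 if θ' j ≥ 0 and s := -1 otherwise, and define y := x₀ + t·s·(Pi.single j 1) (move the entire budget t along coordinate j in the direction of θ' j). Then ‖y - x₀‖₁ = t and L(⟪y,θ'⟫) + λ * ‖y - x₀‖₁ ≤ L(⟪x,θ'⟫) + λ * ‖x - x₀‖₁: against a fixed model θ', concentrating the whole recourse movement on a coordinate maximizing |θ'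 i| is at least as good as any recourse of the same cost (the greedy coordinate choice in line 14 of Algorithm 1 is optimal for a fixed adversary). -/
theorem greedy_coordinate_optimal (d : ℕ) (hd : 1 ≤ d) (x x₀ θ' : Fin d → ℝ) (lam : ℝ)
    (L : ℝ → ℝ) (hL : Antitone L) (j : Fin d) (hj : ∀ i, |θ' i| ≤ |θ' j|)
    (t : ℝ) (ht : t = ∑ i, |x i - x₀ i|)
    (s : ℝ) (hs : s = if 0 ≤ θ' j then (1 : ℝ) else -1)
    (y : Fin d → ℝ) (hy : y = x₀ + (t * s) • (Pi.single j 1 : Fin d → ℝ)) :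
    (∑ i, |y i - x₀ i|) = t ∧
    L (∑ i, y i * θ' i) + lam * ∑ i, |y i - x₀ i| ≤
      L (∑ i, x i * θ' i) + lam * ∑ i, |x i - x₀ i| := by
  have ht0 : 0 ≤ t := ht ▸ Finset.sum_nonneg fun i _ => abs_nonneg _
  have hs1 : |s| = 1 := by rw [hs]; split_ifs <;> simp
  have hs2 : s * θ' j = |θ' j| := by
    rw [hs]
    split_ifs with h
    · rw [abs_of_nonneg h, one_mul]
    · rw [abs_of_neg (not_le.mp h)]; ring
  have hyi : ∀ i, y i - x₀ i = if i = j then t * s else 0 := by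
    intro i
    rw [hy]
    simp [Pi.single_apply]
  have h1 : (∑ i, |y i - x₀ i|) = t := by
    have : ∀ i, |y i - x₀ i| = if i = j then t else 0 := by
      intro i
      rw [hyi]
      split_ifs
      · rw [abs_mul, hs1, mul_one, abs_of_nonneg ht0]
      · simp
    simp [this]
  refine ⟨h1, ?_⟩
  rw [h1, ← ht]
  have h2 : ∑ i, (y i - x₀ i) * θ' i = t * |θ' j| := by
    simp [hyi, mul_assoc, hs2]
  have h3 : ∑ i, (x i - x₀ i) * θ' i ≤ t * |θ' j| := by
    rw [ht, Finset.sum_mul]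
    refine Finset.sum_le_sum fun i _ => ?_
    calc (x i - x₀ i) * θ' i ≤ |(x i - x₀ i) * θ' i| := le_abs_self _
      _ = |x i - x₀ i| * |θ' i| := abs_mul _ _
      _ ≤ _ := mul_le_mul_of_nonneg_left (hj i) (abs_nonneg _)
  have h4 : ∑ i, x i * θ' i ≤ ∑ i, y i * θ' i := by
    simp only [sub_mul, Finset.sum_sub_distrib] at h2 h3
    linarith
  have := hL h4
  linarith
end
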